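/- arXiv:2206.13251 — 5 statements merged into one kernel-verified Lean document; each statement's English description precedes it below -/
import Mathlib

section
/- For every integer n ≥ 3, every convex polygon in the Euclidean plane with n vertices and diameter at most 1 has perimeter at most 2·n·sin(π/(2n)). -/
open Real

/-- Cyclic successor on `Fin n`. -/
def vnext {n : ℕ} (i : Fin n) : Fin n := ⟨(i.1 + 1) % n, Nat.mod_lt _ i.pos⟩

/-- `p` lists the vertices of a convex polygon in the Euclidean plane in
counterclockwise order: every vertex `p j` lies strictly to the left of each
directed edge from `p i` to `p (vnext i)`.  In particular the points are in
convex position (each is an extreme point of their convex hull). -/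
def IsConvexPolygon {n : ℕ} (p : Fin n → EuclideanSpace ℝ (Fin 2)) : Prop :=
  ∀ i j : Fin n, j ≠ i → j ≠ vnext i →
    0 < (p (vnext i) 0 - p i 0) * (p j 1 - p i 1) -
        (p (vnext i) 1 - p i 1) * (p j 0 - p i 0)

/-- The perimeter of the polygon with vertices `p 0, p 1, …, p (n-1)` (in this
cyclic order): the sum of the lengths of its `n` sides. -/
noncomputable def perimeter {n : ℕ} (p : Fin n → EuclideanSpace ℝ (Fin 2)) : ℝ :=
  ∑ i : Fin n, dist (p i) (p (vnext i))

/-- An antiderivative of `φ ↦ |sin (φ - α)|` on `[α - π, α + π]`. -/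
noncomputable def absSinPrimitive (α φ : ℝ) : ℝ :=
  if φ ≤ α then cos (φ - α) - 1 else 1 - cos (φ - α)

lemma absSinPrimitive_of_le {α φ : ℝ} (h : φ ≤ α) :
    absSinPrimitive α φ = cos (φ - α) - 1 := if_pos h

lemma absSinPrimitive_of_ge {α φ : ℝ} (h : α ≤ φ) :
    absSinPrimitive α φ = 1 - cos (φ - α) := by
  rcases h.eq_or_lt with rfl | h
  · simp [absSinPrimitive]
  · exact if_neg h.not_ge

lemma absSinPrimitive_sub_of_notMem {α a b : ℝ} (hab : a ≤ b) (h : α ≤ a ∨ b ≤ α)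
    (hα : b - π ≤ α) (hα' : α ≤ a + π) :
    absSinPrimitive α b - absSinPrimitive α a =
      2 * sin ((b - a) / 2) * |sin ((a + b) / 2 - α)| := by
  have key : cos (a - α) - cos (b - α) = 2 * sin ((b - a) / 2) * sin ((a + b) / 2 - α) := by
    rw [cos_sub_cos, show (a - α + (b - α)) / 2 = (a + b) / 2 - α by ring,
      show (a - α - (b - α)) / 2 = -((b - a) / 2) by ring, sin_neg]
    ring
  rcases h with h | h
  · rw [absSinPrimitive_of_ge h, absSinPrimitive_of_ge (h.trans hab),
      abs_of_nonneg (sin_nonneg_of_nonneg_of_le_pi (by linarith) (by linarith))]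
    linarith
  · rw [absSinPrimitive_of_le h, absSinPrimitive_of_le (hab.trans h),
      abs_of_nonpos (sin_nonpos_of_nonpos_of_neg_pi_le (by linarith) (by linarith))]
    linarith

lemma mul_sin_div_add_le {m k x y : ℝ} (hm : 0 < m) (hk : 0 < k)
    (hx : x / m ∈ Set.Icc 0 π) (hy : y / k ∈ Set.Icc 0 π) :
    m * sin (x / m) + k * sin (y / k) ≤ (m + k) * sin ((x + y) / (m + k)) := by
  have hmk : 0 < m + k := by positivity
  have h := strictConcaveOn_sin_Icc.concaveOn.2 hx hy (div_pos hm hmk).le (div_pos hk hmk).le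
    (by field_simp)
  simp only [smul_eq_mul] at h
  rw [show m / (m + k) * (x / m) + k / (m + k) * (y / k) = (x + y) / (m + k) by
    field_simp] at h
  have h' := mul_le_mul_of_nonneg_left h hmk.le
  calc _ = (m + k) * (m / (m + k) * sin (x / m) + k / (m + k) * sin (y / k)) := by field_simp
    _ ≤ _ := h'

lemma sum_mul_absSinPrimitive_sub_le {ι : Type*} [Fintype ι] {l α : ι → ℝ} {c : ℝ}
    (hS : ∀ φ, ∑ i, l i * |sin (φ - α i)| ≤ 2)
    (hα : ∀ i, c ≤ α i ∧ α i ≤ c + π) (k : ℕ) :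
    ∀ (T : Finset ι) (a b : ℝ), T.card = k → c ≤ a → a ≤ b → b ≤ c + π →
      (∀ i, a < α i → α i < b → i ∈ T) → (∀ i ∈ T, a ≤ α i ∧ α i ≤ b) →
      ∑ i, l i * (absSinPrimitive (α i) b - absSinPrimitive (α i) a) ≤
        4 * ((k + 1) * sin ((b - a) / 2 / (k + 1))) := by
  classical
  induction k using Nat.strong_induction_on with
  | _ k ih =>
  intro T a b hT hca hab hbc hmem hT'
  rcases T.eq_empty_or_nonempty with rfl | ⟨j, hj⟩
  · obtain rfl : k = 0 := by simpa using hT.symm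
    have hsin : 0 ≤ sin ((b - a) / 2) :=
      sin_nonneg_of_nonneg_of_le_pi (by linarith) (by linarith [pi_pos])
    calc _ = 2 * sin ((b - a) / 2) * ∑ i, l i * |sin ((a + b) / 2 - α i)| := by
          rw [Finset.mul_sum]
          refine Finset.sum_congr rfl fun i _ => ?_
          rw [absSinPrimitive_sub_of_notMem hab _ (by linarith [hα i]) (by linarith [hα i])]
          · ring
          · by_contra! h
            exact absurd (hmem i h.1 h.2) (Finset.notMem_empty i)
      _ ≤ 2 * sin ((b - a) / 2) * 2 := mul_le_mul_of_nonneg_left (hS _) (by positivity)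
      _ = _ := by norm_num; ring
  · obtain ⟨haj, hjb⟩ := hT' j hj
    have hcard := Finset.card_filter_add_card_filter_not (s := T.erase j) (fun i => α i < α j)
    rw [Finset.card_erase_of_mem hj, hT] at hcard
    have hk : 0 < k := hT ▸ Finset.card_pos.2 ⟨j, hj⟩
    set T₁ := (T.erase j).filter (fun i => α i < α j) with hT₁
    set T₂ := (T.erase j).filter (fun i => ¬ α i < α j) with hT₂
    have h₁ := ih T₁.card (by omega) T₁ a (α j) rfl hca haj (by linarith)
      (fun i h h' => by
        simp only [hT₁, Finset.mem_filter, Finset.mem_erase]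
        exact ⟨⟨fun e => by simp [e] at h', hmem i h (h'.trans_le hjb)⟩, h'⟩)
      (fun i hi => by
        simp only [hT₁, Finset.mem_filter, Finset.mem_erase] at hi
        exact ⟨(hT' i hi.1.2).1, hi.2.le⟩)
    have h₂ := ih T₂.card (by omega) T₂ (α j) b rfl (by linarith) hjb hbc
      (fun i h h' => by
        simp only [hT₂, Finset.mem_filter, Finset.mem_erase]
        exact ⟨⟨fun e => by simp [e] at h, hmem i (haj.trans_lt h) h'⟩, h.not_gt⟩)
      (fun i hi => by
        simp only [hT₂, Finset.mem_filter, Finset.mem_erase] at hi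
        exact ⟨not_lt.1 hi.2, (hT' i hi.1.2).2⟩)
    have hrange : ∀ (m : ℕ) (x : ℝ), 0 ≤ x → x ≤ π → x / 2 / ((m : ℝ) + 1) ∈ Set.Icc 0 π := by
      intro m x hx hx'
      refine ⟨by positivity, (div_le_self (by positivity) ?_).trans (by linarith)⟩
      have : (0 : ℝ) ≤ m := by positivity
      linarith
    have h₃ := mul_sin_div_add_le (m := T₁.card + 1) (k := T₂.card + 1) (by positivity)
      (by positivity) (hrange T₁.card (α j - a) (by linarith) (by linarith))
      (hrange T₂.card (b - α j) (by linarith) (by linarith))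
    have hsum : (T₁.card : ℝ) + 1 + (T₂.card + 1) = k + 1 := by
      have : T₁.card + 1 + (T₂.card + 1) = k + 1 := by omega
      exact_mod_cast this
    rw [hsum, show (α j - a) / 2 + (b - α j) / 2 = (b - a) / 2 by ring] at h₃
    calc _ = ∑ i, l i * (absSinPrimitive (α i) (α j) - absSinPrimitive (α i) a) +
          ∑ i, l i * (absSinPrimitive (α i) b - absSinPrimitive (α i) (α j)) := by
          rw [← Finset.sum_add_distrib]
          exact Finset.sum_congr rfl fun i _ => by ring
      _ ≤ _ := by linarith

/-- If the weighted sum `∑ l i * |sin (φ - θ i)|` of `n` terms never exceeds `2`, then the weights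
add up to at most `2 n sin (π / (2 n))`. -/
theorem sum_le_of_forall_sum_mul_abs_sin_le {n : ℕ} (hn : 0 < n) {l θ : Fin n → ℝ}
    (hS : ∀ φ, ∑ i, l i * |sin (φ - θ i)| ≤ 2) :
    ∑ i, l i ≤ 2 * n * sin (π / (2 * n)) := by
  classical
  set j : Fin n := ⟨0, hn⟩
  set c := θ j
  set α : Fin n → ℝ := fun i => toIcoMod pi_pos c (θ i) with hαdef
  have hα : ∀ i, c ≤ α i ∧ α i ≤ c + π := fun i =>
    ⟨left_le_toIcoMod _ _ _, (toIcoMod_lt_right _ _ _).le⟩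
  have hαj : α j = c := toIcoMod_apply_left _ _
  have hS' : ∀ φ, ∑ i, l i * |sin (φ - α i)| ≤ 2 := by
    intro φ
    refine le_trans (le_of_eq (Finset.sum_congr rfl fun i _ => ?_)) (hS φ)
    have : φ - α i = φ - θ i + (toIcoDiv pi_pos c (θ i) : ℤ) * π := by
      simp only [hαdef, toIcoMod, zsmul_eq_mul]
      ring
    rw [this, sin_add_int_mul_pi, abs_mul, abs_zpow, abs_neg, abs_one, one_zpow, one_mul]
  have h := sum_mul_absSinPrimitive_sub_le hS' hα (n - 1) (Finset.univ.erase j) c (c + π)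
    (by simp [Finset.card_erase_of_mem]) le_rfl (by linarith [pi_pos]) le_rfl
    (fun i hi _ => Finset.mem_erase.2 ⟨fun e => by simp [e, hαj] at hi, Finset.mem_univ i⟩)
    (fun i _ => hα i)
  have hn' : ((n - 1 : ℕ) : ℝ) + 1 = n := by
    rw [Nat.cast_sub hn]
    simp
  have hval : ∀ i, absSinPrimitive (α i) (c + π) - absSinPrimitive (α i) c = 2 := by
    intro i
    rw [absSinPrimitive_of_ge (hα i).2, absSinPrimitive_of_le (hα i).1,
      show c + π - α i = c - α i + π by ring, cos_add_pi]
    ring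
  simp only [hval] at h
  rw [hn', ← Finset.sum_mul, show (c + π - c) / 2 / (n : ℝ) = π / (2 * n) by
    rw [add_sub_cancel_left, div_div]] at h
  linarith

/-- The total variation of a finite sequence that starts at its minimum and, once it has stopped
increasing, never increases again. -/
lemma exists_sum_abs_sub_le {n : ℕ} {f : ℕ → ℝ} (hmin : ∀ k, f 0 ≤ f k)
    (hstep : ∀ k, 1 ≤ k → k + 1 < n → f (k + 1) ≤ f k → f (k + 2) ≤ f (k + 1)) :
    ∃ j, ∑ k ∈ Finset.range n, |f (k + 1) - f k| ≤ 2 * f j - f 0 - f n := by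
  have key : ∀ m ≤ n, (∑ k ∈ Finset.range m, |f (k + 1) - f k| = f m - f 0) ∨
      (2 ≤ m ∧ f m ≤ f (m - 1) ∧
        ∃ j, ∑ k ∈ Finset.range m, |f (k + 1) - f k| = 2 * f j - f 0 - f m) := by
    intro m
    induction m with
    | zero => simp
    | succ m ih =>
      intro hm
      rw [Finset.sum_range_succ]
      rcases ih (by omega) with h | ⟨h2, hle, j, h⟩
      · rcases le_or_gt (f m) (f (m + 1)) with h' | h'
        · left
          rw [h, abs_of_nonneg (by linarith)]
          ring
        · right
          have hm0 : m ≠ 0 := by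
            rintro rfl
            linarith [hmin (0 + 1)]
          refine ⟨by omega, h'.le, m, ?_⟩
          rw [h, abs_of_nonpos (by linarith)]
          ring
      · right
        obtain ⟨k, rfl⟩ : ∃ k, m = k + 1 := ⟨m - 1, by omega⟩
        have h' := hstep k (by omega) (by omega) hle
        refine ⟨by omega, h', j, ?_⟩
        rw [h, abs_of_nonpos (by linarith)]
        ring
  rcases key n le_rfl with h | ⟨-, -, j, h⟩
  · exact ⟨n, by linarith⟩
  · exact ⟨j, h.le⟩

open scoped Fin.NatCast Fin.CommRing in
/-- The projections of the edges of a convex polygon of diameter at most `1` onto a line have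
total length at most `2`. -/
lemma sum_abs_projection_le_two {n : ℕ} (hn : 3 ≤ n)
    {p : Fin n → EuclideanSpace ℝ (Fin 2)} (hconv : IsConvexPolygon p)
    (hdiam : ∀ i j : Fin n, dist (p i) (p j) ≤ 1) {x y : ℝ} (hxy : x ^ 2 + y ^ 2 = 1) :
    ∑ i, |x * (p (vnext i) 0 - p i 0) + y * (p (vnext i) 1 - p i 1)| ≤ 2 := by
  have : NeZero n := ⟨by omega⟩
  have hnext : ∀ i : Fin n, vnext i = i + 1 := by
    intro i
    ext
    simp [vnext, Fin.val_add]
  set g : Fin n → ℝ := fun i => x * p i 0 + y * p i 1 with hg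
  obtain ⟨o, ho⟩ := Finite.exists_min g
  set f : ℕ → ℝ := fun k => g (o + (k : Fin n)) with hf
  have hf0 : f 0 = g o := by simp [hf]
  have hfn : f n = f 0 := by simp [hf]
  have hne : ∀ a b : ℕ, a < n → b < n → a ≠ b → o + (a : Fin n) ≠ o + (b : Fin n) := by
    intro a b ha hb hab h
    have h := congrArg Fin.val (add_left_cancel h)
    rw [Fin.val_natCast, Fin.val_natCast, Nat.mod_eq_of_lt ha, Nat.mod_eq_of_lt hb] at h
    exact hab h
  have hmin : ∀ k, f 0 ≤ f k := fun k => hf0 ▸ ho _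
  obtain ⟨j, hj⟩ := exists_sum_abs_sub_le (n := n) hmin (by
    intro k hk hkn hle
    by_contra! hlt
    have hk2 : k + 2 < n := by
      rcases Nat.lt_or_ge (k + 2) n with h | h
      · exact h
      · rw [show k + 2 = n by omega, hfn] at hlt
        linarith [hmin (k + 1)]
    have hv : ∀ a : ℕ, vnext (o + (a : Fin n)) = o + ((a + 1 : ℕ) : Fin n) := by
      intro a
      rw [hnext]
      push_cast
      ring
    have c₁ := hconv (o + (k : Fin n)) (o + ((k + 2 : ℕ) : Fin n))
      (hne _ _ hk2 (by omega) (by omega)) (by rw [hv]; exact hne _ _ hk2 (by omega) (by omega))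
    have c₂ := hconv (o + (k : Fin n)) (o + ((0 : ℕ) : Fin n))
      (hne _ _ (by omega) (by omega) (by omega))
      (by rw [hv]; exact hne _ _ (by omega) (by omega) (by omega))
    have c₃ := hconv (o + ((k + 1 : ℕ) : Fin n)) (o + ((0 : ℕ) : Fin n))
      (hne _ _ (by omega) (by omega) (by omega))
      (by rw [hv]; exact hne _ _ (by omega) (by omega) (by omega))
    have hm := hmin (k + 1)
    rw [hv] at c₁ c₂ c₃
    simp only [hf, hg, add_assoc, one_add_one_eq_two] at hle hlt hm c₁ c₂ c₃
    generalize p (o + (k : Fin n)) = A at *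
    generalize p (o + ((k + 1 : ℕ) : Fin n)) = B at *
    generalize p (o + ((k + 2 : ℕ) : Fin n)) = C at *
    generalize p (o + ((0 : ℕ) : Fin n)) = D at *
    have e₁ := mul_pos c₂ (sub_pos.2 hlt)
    have e₂ := mul_nonneg c₃.le (sub_nonneg.2 hle)
    have e₃ := mul_nonneg c₁.le (sub_nonneg.2 hm)
    nlinarith)
  have hsum : ∑ i, |x * (p (vnext i) 0 - p i 0) + y * (p (vnext i) 1 - p i 1)| =
      ∑ k ∈ Finset.range n, |f (k + 1) - f k| := by
    rw [← Fin.sum_univ_eq_sum_range (fun k => |f (k + 1) - f k|) n,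
      ← Equiv.sum_comp (Equiv.addLeft o)]
    refine Finset.sum_congr rfl fun i _ => ?_
    simp only [hf, hg, hnext, Equiv.coe_addLeft, Nat.cast_add, Nat.cast_one, Fin.cast_val_eq_self,
      add_assoc]
    congr 1
    ring
  have hwidth : f j - f 0 ≤ 1 := by
    have hd := hdiam (o + (j : Fin n)) o
    rw [EuclideanSpace.dist_eq, Real.sqrt_le_iff, Fin.sum_univ_two, Real.dist_eq, Real.dist_eq,
      sq_abs, sq_abs] at hd
    rw [hf0]
    simp only [hf, hg]
    generalize p (o + (j : Fin n)) = A at *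
    nlinarith [sq_nonneg (x - (A 0 - p o 0)), sq_nonneg (y - (A 1 - p o 1))]
  rw [hsum]
  linarith

/-- Reinhardt's upper bound: every convex `n`-gon of diameter at most `1`
(`n ≥ 3`) has perimeter at most `2 n sin (π / (2 n))`. -/
theorem perimeter_le_of_small_convex_polygon (n : ℕ) (hn : 3 ≤ n)
    (p : Fin n → EuclideanSpace ℝ (Fin 2)) (hconv : IsConvexPolygon p)
    (hdiam : ∀ i j : Fin n, dist (p i) (p j) ≤ 1) :
    perimeter p ≤ 2 * n * Real.sin (π / (2 * n)) := by
  set z : Fin n → ℂ := fun i => ⟨p (vnext i) 0 - p i 0, p (vnext i) 1 - p i 1⟩ with hz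
  have hnorm : ∀ i, dist (p i) (p (vnext i)) = ‖z i‖ := by
    intro i
    rw [dist_comm, EuclideanSpace.dist_eq, Fin.sum_univ_two, Real.dist_eq, Real.dist_eq, sq_abs,
      sq_abs, Complex.norm_eq_sqrt_sq_add_sq]
  simp only [perimeter, hnorm]
  refine sum_le_of_forall_sum_mul_abs_sin_le (θ := fun i => (z i).arg) (by omega) fun φ => ?_
  refine le_trans (le_of_eq (Finset.sum_congr rfl fun i _ => ?_))
    (sum_abs_projection_le_two hn hconv hdiam (x := sin φ) (y := -cos φ)
      (by rw [neg_sq, sin_sq_add_cos_sq]))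
  have hre : ‖z i‖ * cos (z i).arg = p (vnext i) 0 - p i 0 := Complex.norm_mul_cos_arg (z i)
  have him : ‖z i‖ * sin (z i).arg = p (vnext i) 1 - p i 1 := Complex.norm_mul_sin_arg (z i)
  rw [← hre, ← him, ← abs_of_nonneg (norm_nonneg (z i)), ← abs_mul, abs_of_nonneg (norm_nonneg _),
    sin_sub]
  congr 1
  ring
end

section
/- For every integer n ≥ 3 that is not a power of 2, there exists a convex polygon in the Euclidean plane with n vertices and diameter at most 1 whose perimeter equals 2·n·sin(π/(2n)). -/
open Real

/-- Index, in units of `π / n`, of the direction of the `k`-th side: directions come in runs of `q`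
consecutive indices, separated by gaps of length `q`. -/
def sideIndex (q k : ℕ) : ℕ := k + q * (k / q)

lemma sideIndex_strictMono (q : ℕ) : StrictMono (sideIndex q) := fun _ _ h =>
  add_lt_add_of_lt_of_le h (Nat.mul_le_mul_left q (Nat.div_le_div_right h.le))

lemma sideIndex_add {q : ℕ} (hq : 0 < q) (m k : ℕ) :
    sideIndex q (k + q * m) = sideIndex q k + 2 * (q * m) := by
  simp only [sideIndex, Nat.add_mul_div_left _ _ hq]
  ring

lemma sideIndex_ne_add {q m : ℕ} (hq : 0 < q) (hm : Odd m) (i k : ℕ) :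
    sideIndex q k ≠ sideIndex q i + q * m := by
  intro h
  have := congrArg (· / q) h
  simp only [sideIndex, Nat.add_mul_div_left _ _ hq] at this
  obtain ⟨r, rfl⟩ := hm
  omega

/-- The unit vector at angle `π a / n`. -/
noncomputable def unitDir (n a : ℕ) : ℂ := Complex.exp ((π * a / n : ℝ) * Complex.I)

lemma unitDir_re (n a : ℕ) : (unitDir n a).re = cos (π * a / n) :=
  Complex.exp_ofReal_mul_I_re _

lemma unitDir_im (n a : ℕ) : (unitDir n a).im = sin (π * a / n) :=
  Complex.exp_ofReal_mul_I_im _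

lemma norm_unitDir (n a : ℕ) : ‖unitDir n a‖ = 1 := Complex.norm_exp_ofReal_mul_I _

lemma unitDir_add (n a b : ℕ) : unitDir n (a + b) = unitDir n a * unitDir n b := by
  rw [unitDir, unitDir, unitDir, ← Complex.exp_add]
  congr 1
  push_cast
  ring

lemma unitDir_two_mul_self {n : ℕ} (hn : 0 < n) : unitDir n (2 * n) = 1 := by
  have hn' : (n : ℂ) ≠ 0 := by exact_mod_cast hn.ne'
  rw [unitDir, ← Complex.exp_two_pi_mul_I]
  congr 1
  push_cast
  field_simp

lemma sum_unitDir_sideIndex {q m : ℕ} (hq : 0 < q) (hm : 1 < m) :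
    ∑ k ∈ Finset.range (q * m), unitDir (q * m) (sideIndex q k) = 0 := by
  have hq' : (q : ℂ) ≠ 0 := by exact_mod_cast hq.ne'
  have hm' : (m : ℂ) ≠ 0 := by exact_mod_cast (by omega : m ≠ 0)
  have key : ∀ b, ∑ k ∈ Finset.range (q * b), unitDir (q * m) (sideIndex q k) =
      (∑ c ∈ Finset.range b, Complex.exp (2 * π * Complex.I / m) ^ c) *
        ∑ r ∈ Finset.range q, unitDir (q * m) r := by
    intro b
    induction b with
    | zero => simp
    | succ b ih =>
      rw [Nat.mul_succ, Finset.sum_range_add, ih, Finset.sum_range_succ, add_mul]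
      congr 1
      rw [Finset.mul_sum]
      refine Finset.sum_congr rfl fun r hr => ?_
      have hr' : (q * b + r) / q = b := by
        rw [Nat.mul_add_div hq, Nat.div_eq_of_lt (Finset.mem_range.1 hr), add_zero]
      rw [sideIndex, hr', ← Complex.exp_nat_mul, unitDir, unitDir, ← Complex.exp_add]
      congr 1
      push_cast
      field_simp
      ring
  rw [key, (Complex.isPrimitiveRoot_exp m (by omega)).geom_sum_eq_zero hm, zero_mul]

/-- The total width of `n` equally spaced lines is at most that of the regular `2n`-gon. -/
lemma sin_mul_sum_abs_cos_le {n : ℕ} (hn : 0 < n) (x : ℝ) :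
    sin (π / (2 * n)) * ∑ k ∈ Finset.range n, |cos (x - π * k / n)| ≤ 1 := by
  have hn' : (0 : ℝ) < n := by exact_mod_cast hn
  have hper : Function.Periodic
      (fun x : ℝ => ∑ k ∈ Finset.range n, |cos (x - π * k / n)|) (π / n) := by
    intro x
    obtain ⟨m, rfl⟩ : ∃ m, n = m + 1 := ⟨n - 1, by omega⟩
    simp only
    rw [Finset.sum_range_succ', Finset.sum_range_succ]
    congr 1
    · refine Finset.sum_congr rfl fun k _ => ?_
      congr 2
      push_cast
      ring
    · rw [← abs_neg, ← cos_sub_pi]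
      congr 2
      push_cast
      field_simp
      ring
  obtain ⟨y, ⟨hy1, hy2⟩, hy⟩ := hper.exists_mem_Ico (by positivity) x (π / 2 - π / n)
  rw [hy, Finset.mul_sum]
  have hterm : ∀ k ∈ Finset.range n, sin (π / (2 * n)) * |cos (y - π * k / n)| =
      sin (y + π / (2 * n) - π * k / n) / 2 -
        sin (y + π / (2 * n) - π * (k + 1 : ℕ) / n) / 2 := by
    intro k hk
    have hk' : (k : ℝ) + 1 ≤ n := by exact_mod_cast Finset.mem_range.1 hk
    have h1 : π * k / n + π / n ≤ π := by
      rw [← add_div, div_le_iff₀ hn']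
      nlinarith [pi_pos]
    have h0 : 0 ≤ π * k / n := by positivity
    rw [abs_of_nonneg (cos_nonneg_of_neg_pi_div_two_le_of_le (by linarith) (by linarith))]
    have e1 : y + π / (2 * n) - π * k / n = (y - π * k / n) + π / (2 * n) := by ring
    have e2 : y + π / (2 * n) - π * (k + 1 : ℕ) / n = (y - π * k / n) - π / (2 * n) := by
      push_cast
      field_simp
      ring
    rw [e1, e2, sin_add, sin_sub (y - π * k / n)]
    ring
  rw [Finset.sum_congr rfl hterm, Finset.sum_range_sub']
  have e : y + π / (2 * n) - π * (n : ℕ) / n = y + π / (2 * n) - π := by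
    field_simp
  rw [e, sin_sub_pi]
  have := sin_le_one (y + π / (2 * n) - π * (0 : ℕ) / n)
  simp only [Nat.cast_zero, mul_zero, zero_div, sub_zero] at this ⊢
  linarith

lemma abs_cos_sub_mod (n a : ℕ) (hn : 0 < n) (x : ℝ) :
    |cos (x - π * (a % n : ℕ) / n)| = |cos (x - π * a / n)| := by
  have hn' : (n : ℝ) ≠ 0 := by exact_mod_cast hn.ne'
  have h : (a : ℝ) = (a % n : ℕ) + n * (a / n : ℕ) := by exact_mod_cast (Nat.mod_add_div a n).symm
  have e : x - π * a / n = (x - π * (a % n : ℕ) / n) - (a / n : ℕ) * π := by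
    conv_lhs => rw [h]
    field_simp
    ring
  rw [e, cos_sub_nat_mul_pi, abs_mul, abs_pow, abs_neg, abs_one, one_pow, one_mul]

section Polygon

variable {n : ℕ} {a : ℕ → ℕ}

/-- The endpoint of the path formed by the first `j` sides, of common length `2 sin (π / (2n))`
and with directions `a 0, a 1, …` in units of `π / n`. -/
noncomputable def pathVertex (n : ℕ) (a : ℕ → ℕ) (j : ℕ) : ℂ :=
  (2 * sin (π / (2 * n)) : ℝ) * ∑ k ∈ Finset.range j, unitDir n (a k)

lemma pathVertex_sub {i j : ℕ} (h : i ≤ j) : pathVertex n a j - pathVertex n a i =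
    (2 * sin (π / (2 * n)) : ℝ) * ∑ k ∈ Finset.Ico i j, unitDir n (a k) := by
  rw [pathVertex, pathVertex, ← mul_sub, Finset.sum_Ico_eq_sub _ h]

lemma pathVertex_periodic (hn : 0 < n) (hadd : ∀ k, a (k + n) = a k + 2 * n)
    (hsum : ∑ k ∈ Finset.range n, unitDir n (a k) = 0) :
    Function.Periodic (pathVertex n a) n := by
  intro j
  rw [pathVertex, pathVertex, add_comm, Finset.sum_range_add, hsum, zero_add]
  simp only [add_comm n, hadd, unitDir_add, unitDir_two_mul_self hn, mul_one]

lemma sin_pi_div_two_mul_pos (hn : 0 < n) : 0 < sin (π / (2 * n)) := by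
  have hn' : (1 : ℝ) ≤ n := by exact_mod_cast hn
  refine sin_pos_of_pos_of_lt_pi (by positivity) ?_
  rw [div_lt_iff₀ (by positivity)]
  nlinarith [pi_pos]

lemma sum_abs_cos_eq (hn : 0 < n) (hmono : StrictMono a) (hadd : ∀ k, a (k + n) = a k + 2 * n)
    (hne : ∀ i k, a k ≠ a i + n) (x : ℝ) :
    ∑ k ∈ Finset.range n, |cos (x - π * a k / n)| =
      ∑ k ∈ Finset.range n, |cos (x - π * k / n)| := by
  have hinj : Set.InjOn (fun k => a k % n) (Finset.range n) := by
    have aux : ∀ i k, i < k → k < n → a i % n ≠ a k % n := by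
      intro i k hik hk h
      have h1 := hmono hik
      have h2 : a k < a i + 2 * n := by
        rw [← hadd]
        exact hmono (by omega)
      obtain ⟨c, hc⟩ := (Nat.modEq_iff_dvd' h1.le).1 h
      have hc0 : 0 < c := Nat.pos_of_ne_zero (by rintro rfl; omega)
      have hc2 : c < 2 := by
        by_contra! hc2
        have := Nat.mul_le_mul_left n hc2
        omega
      obtain rfl : c = 1 := by omega
      exact hne i k (by omega)
    intro i hi k hk h
    simp only [Finset.coe_range, Set.mem_Iio] at hi hk
    rcases lt_trichotomy i k with hik | hik | hik
    · exact absurd h (aux i k hik hk)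
    · exact hik
    · exact absurd h.symm (aux k i hik hi)
  have himg : (Finset.range n).image (fun k => a k % n) = Finset.range n := by
    refine Finset.eq_of_subset_of_card_le ?_ (Finset.card_image_of_injOn hinj).ge
    intro b hb
    obtain ⟨k, -, rfl⟩ := Finset.mem_image.1 hb
    exact Finset.mem_range.2 (Nat.mod_lt _ hn)
  conv_rhs => rw [← himg, Finset.sum_image hinj]
  exact Finset.sum_congr rfl fun k _ => (abs_cos_sub_mod n (a k) hn x).symm

lemma norm_pathVertex_sub_le (hn : 0 < n) (hmono : StrictMono a)
    (hadd : ∀ k, a (k + n) = a k + 2 * n) (hne : ∀ i k, a k ≠ a i + n)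
    (hsum : ∑ k ∈ Finset.range n, unitDir n (a k) = 0) {i j : ℕ} (hij : i ≤ j) (hj : j ≤ n) :
    ‖pathVertex n a j - pathVertex n a i‖ ≤ 1 := by
  rw [pathVertex_sub hij, norm_mul, Complex.norm_real, Real.norm_of_nonneg
    (mul_nonneg zero_le_two (sin_pi_div_two_mul_pos hn).le)]
  set z := ∑ k ∈ Finset.Ico i j, unitDir n (a k) with hz
  have h2z : 2 * z =
      ∑ k ∈ Finset.range n, ((if k ∈ Finset.Ico i j then 1 else -1 : ℝ) : ℂ) * unitDir n (a k) := by
    have hsub : Finset.Ico i j ⊆ Finset.range n := fun k hk =>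
      Finset.mem_range.2 ((Finset.mem_Ico.1 hk).2.trans_le hj)
    have hz' : z = ∑ k ∈ Finset.range n, if k ∈ Finset.Ico i j then unitDir n (a k) else 0 := by
      rw [Finset.sum_ite_mem, Finset.inter_eq_right.2 hsub]
    rw [← sub_zero (2 * z), ← hsum, hz', Finset.mul_sum, ← Finset.sum_sub_distrib]
    refine Finset.sum_congr rfl fun k _ => ?_
    split_ifs <;> push_cast <;> ring
  have hle : 2 * ‖z‖ ≤ ∑ k ∈ Finset.range n, |cos (z.arg - π * a k / n)| := by
    have hre : 2 * ‖z‖ = (2 * z * Complex.exp (-(z.arg * Complex.I))).re := by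
      conv_rhs => rw [← Complex.norm_mul_exp_arg_mul_I z]
      rw [← mul_assoc, mul_assoc, ← Complex.exp_add]
      simp
    rw [hre, h2z, Finset.sum_mul, Complex.re_sum]
    refine Finset.sum_le_sum fun k _ => ?_
    rw [mul_assoc, Complex.re_ofReal_mul, unitDir, ← Complex.exp_add]
    have : ((π * a k / n : ℝ) : ℂ) * Complex.I + -(z.arg * Complex.I) =
        ((-(z.arg - π * a k / n) : ℝ) : ℂ) * Complex.I := by
      push_cast
      ring
    rw [this, Complex.exp_ofReal_mul_I_re, cos_neg]
    refine (le_abs_self _).trans ?_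
    rw [abs_mul]
    split_ifs <;> simp
  rw [sum_abs_cos_eq hn hmono hadd hne] at hle
  calc 2 * sin (π / (2 * n)) * ‖z‖ = sin (π / (2 * n)) * (2 * ‖z‖) := by ring
    _ ≤ _ := mul_le_mul_of_nonneg_left hle (sin_pi_div_two_mul_pos hn).le
    _ ≤ 1 := sin_mul_sum_abs_cos_le hn _

lemma sum_sin_pos (hn : 0 < n) (hmono : StrictMono a) (hadd : ∀ k, a (k + n) = a k + 2 * n)
    (hne : ∀ i k, a k ≠ a i + n)
    (hsum : ∑ k ∈ Finset.range n, unitDir n (a k) = 0) {i j : ℕ} (hij : i + 1 < j)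
    (hj : j < i + n) :
    0 < ∑ k ∈ Finset.Ico i j, sin (π * a k / n - π * a i / n) := by
  have hn' : (0 : ℝ) < n := by exact_mod_cast hn
  have hsin_pos : ∀ k, a i < a k → a k < a i + n → 0 < sin (π * a k / n - π * a i / n) := by
    intro k h1 h2
    have h1' : (a i : ℝ) < a k := by exact_mod_cast h1
    have h2' : (a k : ℝ) < a i + n := by exact_mod_cast h2
    have e : π * a k / n - π * a i / n = π * ((a k - a i) / n) := by ring
    rw [e]
    have h3 : ((a k : ℝ) - a i) / n < 1 := (div_lt_one hn').2 (by linarith)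
    have h4 : 0 < ((a k : ℝ) - a i) / n := div_pos (by linarith) hn'
    exact sin_pos_of_pos_of_lt_pi (by positivity) (by nlinarith [pi_pos])
  have hsin_neg : ∀ k, a i + n < a k → a k < a i + 2 * n →
      sin (π * a k / n - π * a i / n) < 0 := by
    intro k h1 h2
    have h1' : (a i : ℝ) + n < a k := by exact_mod_cast h1
    have h2' : (a k : ℝ) < a i + 2 * n := by exact_mod_cast h2
    have e : π * a k / n - π * a i / n = π * ((a k - a i) / n - 2) + 2 * π := by ring
    rw [e, sin_add_two_pi]
    have h3 : ((a k : ℝ) - a i) / n < 2 := (div_lt_iff₀ hn').2 (by linarith)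
    have h4 : 1 < ((a k : ℝ) - a i) / n := (one_lt_div hn').2 (by linarith)
    exact sin_neg_of_neg_of_neg_pi_lt (by nlinarith [pi_pos]) (by nlinarith [pi_pos])
  by_cases hlast : a (j - 1) < a i + n
  · rw [Finset.sum_eq_sum_Ico_succ_bot (by omega), sub_self, sin_zero, zero_add]
    refine Finset.sum_pos (fun k hk => ?_) ⟨i + 1, by simp [hij]⟩
    rw [Finset.mem_Ico] at hk
    exact hsin_pos k (hmono (by omega)) ((hmono.monotone (by omega : k ≤ j - 1)).trans_lt hlast)
  · have hlt : a i + n < a (j - 1) := lt_of_le_of_ne (not_lt.1 hlast) (hne i _).symm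
    have htail : ∑ k ∈ Finset.Ico j (i + n), sin (π * a k / n - π * a i / n) < 0 := by
      refine Finset.sum_neg (fun k hk => ?_) ⟨j, by simp [hj]⟩
      rw [Finset.mem_Ico] at hk
      refine hsin_neg k (hlt.trans (hmono (by omega))) ?_
      rw [← hadd]
      exact hmono hk.2
    have hz : ∑ k ∈ Finset.Ico i (i + n), unitDir n (a k) = 0 := by
      have hs := pathVertex_sub (n := n) (a := a) (Nat.le_add_right i n)
      rw [pathVertex_periodic hn hadd hsum i, sub_self] at hs
      refine (mul_eq_zero.1 hs.symm).resolve_left ?_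
      exact_mod_cast (mul_pos two_pos (sin_pi_div_two_mul_pos hn)).ne'
    have htotal : ∑ k ∈ Finset.Ico i (i + n), sin (π * a k / n - π * a i / n) = 0 := by
      have hre := congrArg Complex.re hz
      have him := congrArg Complex.im hz
      simp only [Complex.re_sum, Complex.im_sum, unitDir_re, unitDir_im, Complex.zero_re,
        Complex.zero_im] at hre him
      simp only [sin_sub, Finset.sum_sub_distrib, ← Finset.sum_mul, hre, him, zero_mul, sub_zero]
    rw [← Finset.sum_Ico_consecutive _ (by omega : i ≤ j) hj.le] at htotal
    linarith

lemma pathVertex_cross_pos (hn : 0 < n) (hmono : StrictMono a)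
    (hadd : ∀ k, a (k + n) = a k + 2 * n) (hne : ∀ i k, a k ≠ a i + n)
    (hsum : ∑ k ∈ Finset.range n, unitDir n (a k) = 0) {i j : ℕ} (hij : i + 1 < j)
    (hj : j < i + n) :
    0 < (pathVertex n a (i + 1) - pathVertex n a i).re * (pathVertex n a j - pathVertex n a i).im -
      (pathVertex n a (i + 1) - pathVertex n a i).im *
        (pathVertex n a j - pathVertex n a i).re := by
  have hpos := mul_pos (pow_pos (mul_pos two_pos (sin_pi_div_two_mul_pos hn)) 2)
    (sum_sin_pos hn hmono hadd hne hsum hij hj)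
  refine hpos.trans_eq ?_
  rw [pathVertex_sub (Nat.le_succ i), pathVertex_sub (by omega : i ≤ j), Nat.succ_eq_add_one,
    Nat.Ico_succ_singleton, Finset.sum_singleton]
  simp only [Complex.re_ofReal_mul, Complex.im_ofReal_mul, Complex.re_sum, Complex.im_sum,
    unitDir_re, unitDir_im, sin_sub, Finset.sum_sub_distrib, ← Finset.sum_mul]
  ring

/-- The closed path `pathVertex n a` as a polygon in the Euclidean plane. -/
noncomputable def pathPolygon (n : ℕ) (a : ℕ → ℕ) (i : Fin n) : EuclideanSpace ℝ (Fin 2) :=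
  !₂[(pathVertex n a i).re, (pathVertex n a i).im]

lemma dist_pathPolygon (i j : Fin n) :
    dist (pathPolygon n a i) (pathPolygon n a j) = ‖pathVertex n a j - pathVertex n a i‖ := by
  rw [← dist_eq_norm, dist_comm (pathVertex n a j), Complex.dist_eq_re_im, EuclideanSpace.dist_eq,
    Fin.sum_univ_two]
  simp [pathPolygon, Real.dist_eq, sq_abs]

lemma pathVertex_vnext (hper : Function.Periodic (pathVertex n a) n) (i : Fin n) :
    pathVertex n a (vnext i) = pathVertex n a (i + 1) :=
  hper.map_mod_nat _

lemma isConvexPolygon_pathPolygon (hn : 0 < n) (hmono : StrictMono a)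
    (hadd : ∀ k, a (k + n) = a k + 2 * n) (hne : ∀ i k, a k ≠ a i + n)
    (hsum : ∑ k ∈ Finset.range n, unitDir n (a k) = 0) :
    IsConvexPolygon (pathPolygon n a) := by
  have hper := pathVertex_periodic hn hadd hsum
  intro i j hji hjs
  have hj' : ∃ j' : ℕ, pathVertex n a j' = pathVertex n a j ∧ i + 1 < j' ∧ j' < i + n := by
    have hi := i.2
    have hj := j.2
    have hji' : (j : ℕ) ≠ i := Fin.val_ne_of_ne hji
    have hjs' : (j : ℕ) ≠ (i + 1) % n := Fin.val_ne_of_ne hjs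
    rcases lt_or_gt_of_ne hji' with h | h
    · refine ⟨j + n, hper j, ?_, by omega⟩
      by_contra! hle
      have : (i : ℕ) + 1 = n := by omega
      rw [this, Nat.mod_self] at hjs'
      omega
    · rw [Nat.mod_eq_of_lt (by omega)] at hjs'
      exact ⟨j, rfl, by omega, by omega⟩
  obtain ⟨j', hjv, h1, h2⟩ := hj'
  have := pathVertex_cross_pos hn hmono hadd hne hsum h1 h2
  rw [hjv, ← pathVertex_vnext hper] at this
  simpa [pathPolygon] using this

lemma dist_pathPolygon_le (hn : 0 < n) (hmono : StrictMono a)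
    (hadd : ∀ k, a (k + n) = a k + 2 * n) (hne : ∀ i k, a k ≠ a i + n)
    (hsum : ∑ k ∈ Finset.range n, unitDir n (a k) = 0) (i j : Fin n) :
    dist (pathPolygon n a i) (pathPolygon n a j) ≤ 1 := by
  rw [dist_pathPolygon]
  rcases le_total (i : ℕ) j with h | h
  · exact norm_pathVertex_sub_le hn hmono hadd hne hsum h j.2.le
  · rw [norm_sub_rev]
    exact norm_pathVertex_sub_le hn hmono hadd hne hsum h i.2.le

lemma perimeter_pathPolygon (hn : 0 < n) (hadd : ∀ k, a (k + n) = a k + 2 * n)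
    (hsum : ∑ k ∈ Finset.range n, unitDir n (a k) = 0) :
    perimeter (pathPolygon n a) = 2 * n * sin (π / (2 * n)) := by
  have hside : ∀ i : Fin n,
      dist (pathPolygon n a i) (pathPolygon n a (vnext i)) = 2 * sin (π / (2 * n)) := by
    intro i
    rw [dist_pathPolygon, pathVertex_vnext (pathVertex_periodic hn hadd hsum),
      pathVertex_sub (Nat.le_succ _), Nat.succ_eq_add_one, Nat.Ico_succ_singleton,
      Finset.sum_singleton, norm_mul, norm_unitDir, mul_one, Complex.norm_real,
      Real.norm_of_nonneg (mul_nonneg zero_le_two (sin_pi_div_two_mul_pos hn).le)]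
  simp only [perimeter, hside, Finset.sum_const, Finset.card_univ, Fintype.card_fin, nsmul_eq_mul]
  ring

end Polygon

/-- Attainability in Reinhardt's theorem: if `n ≥ 3` is not a power of `2`,
there is a convex `n`-gon of diameter at most `1` whose perimeter equals
`2 n sin (π / (2 n))`. -/
theorem exists_small_convex_polygon_with_max_perimeter (n : ℕ) (hn : 3 ≤ n)
    (hnotpow : ¬ ∃ k : ℕ, n = 2 ^ k) :
    ∃ p : Fin n → EuclideanSpace ℝ (Fin 2), IsConvexPolygon p ∧
      (∀ i j : Fin n, dist (p i) (p j) ≤ 1) ∧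
      perimeter p = 2 * n * Real.sin (π / (2 * n)) := by
  obtain ⟨k, m, hm, rfl⟩ := Nat.exists_eq_two_pow_mul_odd (by omega : n ≠ 0)
  have hq : 0 < 2 ^ k := by positivity
  have hm1 : 1 < m := by
    refine lt_of_le_of_ne hm.pos fun h => hnotpow ⟨k, ?_⟩
    rw [← h, mul_one]
  have hpos : 0 < 2 ^ k * m := by omega
  have hmono := sideIndex_strictMono (2 ^ k)
  have hadd := sideIndex_add hq m
  have hne := sideIndex_ne_add hq hm
  have hsum := sum_unitDir_sideIndex hq hm1
  exact ⟨pathPolygon _ (sideIndex (2 ^ k)),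
    isConvexPolygon_pathPolygon hpos hmono hadd hne hsum,
    dist_pathPolygon_le hpos hmono hadd hne hsum,
    perimeter_pathPolygon hpos hadd hsum⟩
end

section
/- For every integer n ≥ 4 that is a power of 2, every convex polygon in the Euclidean plane with n vertices and diameter at most 1 has perimeter strictly less than 2·n·sin(π/(2n)). -/
open Real

/-- The cross product of two plane vectors. -/
def cross (a b : ℂ) : ℝ := a.re * b.im - a.im * b.re

lemma cross_sub_left (a b c : ℂ) : cross (a - b) c = cross a c - cross b c := by
  simp only [cross, Complex.sub_re, Complex.sub_im]; ring

lemma cross_neg_right (a b : ℂ) : cross a (-b) = -cross a b := by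
  simp only [cross, Complex.neg_re, Complex.neg_im]; ring

/-- A local maximum of a linear functional on a convex polygon is a strict global maximum. -/
lemma cross_lt_of_local_max {ι : Type*} (τ : Equiv.Perm ι)
    (h2 : ∀ i, τ (τ i) ≠ i) (z : ι → ℂ)
    (hconv : ∀ i j, j ≠ i → j ≠ τ i → 0 < cross (z (τ i) - z i) (z j - z i)) (w : ℂ) (m j : ι)
    (hpos : 0 < cross (z (τ m) - z m) w) (hneg : cross (z (τ (τ m)) - z (τ m)) w < 0)
    (hj : j ≠ τ m) : cross (z j) w < cross (z (τ m)) w := by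
  have h1 : ∀ i, τ i ≠ i := fun i hi => h2 i (by rw [hi, hi])
  have hD := hconv m (τ (τ m)) (h2 m) (h1 _)
  set a := z (τ m) - z m with ha
  set b := z (τ (τ m)) - z (τ m) with hb
  set x := z j - z (τ m) with hx
  have hA : cross a (z j - z m) = cross a x := by
    simp only [ha, hx, cross, Complex.sub_re, Complex.sub_im]; ring
  have hD' : 0 < cross a b := by
    have : cross a (z (τ (τ m)) - z m) = cross a b := by
      simp only [ha, hb, cross, Complex.sub_re, Complex.sub_im]; ring
    rwa [this] at hD
  have hax : 0 ≤ cross a x ∧ (j ≠ m → 0 < cross a x) := by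
    by_cases hjm : j = m
    · refine ⟨le_of_eq ?_, fun h => absurd hjm h⟩
      simp only [ha, hx, hjm, cross, Complex.sub_re, Complex.sub_im]; ring
    · have := hconv m j hjm hj
      rw [← ha, hA] at this
      exact ⟨this.le, fun _ => this⟩
  have hbx : 0 ≤ cross b x ∧ (j ≠ τ (τ m) → 0 < cross b x) := by
    by_cases hjm : j = τ (τ m)
    · refine ⟨le_of_eq ?_, fun h => absurd hjm h⟩
      simp only [hb, hx, hjm, cross, Complex.sub_re, Complex.sub_im]; ring
    · have := hconv (τ m) j hj hjm
      exact ⟨this.le, fun _ => this⟩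
  have key : cross a b * cross x w = -(cross b x * cross a w) + cross a x * cross b w := by
    simp only [cross]; ring
  have hlt : cross a b * cross x w < 0 := by
    rw [key]
    by_cases hjm : j = m
    · have := mul_pos (hbx.2 (by rw [hjm]; exact (h2 m).symm)) hpos
      have := mul_nonpos_of_nonneg_of_nonpos hax.1 hneg.le
      linarith
    · have := mul_neg_of_pos_of_neg (hax.2 hjm) hneg
      have := mul_nonneg hbx.1 hpos.le
      linarith
  have := neg_of_mul_neg_right hlt hD'.le
  rw [hx, cross_sub_left] at this
  linarith

/-- The edges of a convex polygon of diameter at most one on which a linear functional is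
positive sum to a difference of two vertices. -/
lemma norm_sum_sign_edges_le {ι : Type*} [Fintype ι] [Nonempty ι] (τ : Equiv.Perm ι)
    (h2 : ∀ i, τ (τ i) ≠ i) (z : ι → ℂ)
    (hconv : ∀ i j, j ≠ i → j ≠ τ i → 0 < cross (z (τ i) - z i) (z j - z i))
    (hdiam : ∀ i j, ‖z i - z j‖ ≤ 1) (w : ℂ) (s : ι → ℝ)
    (hs : ∀ i, (s i = 1 ∧ 0 < cross (z (τ i) - z i) w) ∨
      (s i = -1 ∧ cross (z (τ i) - z i) w < 0)) :
    ‖∑ i, (s i / 2 : ℂ) * (z (τ i) - z i)‖ ≤ 1 := by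
  classical
  obtain ⟨a, ha⟩ := Finite.exists_max fun i => cross (z i) w
  obtain ⟨b, hb⟩ := Finite.exists_min fun i => cross (z i) w
  have hmax : ∀ m, s m = 1 → s (τ m) = -1 → τ m = a := by
    intro m hm hm'
    by_contra hne
    have h := cross_lt_of_local_max τ h2 z hconv w m a
      ((hs m).elim (·.2) fun h => by linarith [h.1])
      ((hs (τ m)).elim (fun h => by linarith [h.1]) (·.2)) (Ne.symm hne)
    exact absurd (ha (τ m)) (not_le.2 h)
  have hmin : ∀ m, s m = -1 → s (τ m) = 1 → τ m = b := by
    intro m hm hm'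
    by_contra hne
    have h := cross_lt_of_local_max τ h2 z hconv (-w) m b
      (by rw [cross_neg_right]; exact (hs m).elim (fun h => by linarith [h.1]) (by linarith [·.2]))
      (by
        rw [cross_neg_right]
        exact (hs (τ m)).elim (by linarith [·.2]) (fun h => by linarith [h.1])) (Ne.symm hne)
    rw [cross_neg_right, cross_neg_right] at h
    linarith [hb (τ m)]
  have hd : ∀ m, (s m / 2 - s (τ m) / 2 : ℂ)
      = (if τ m = a then 1 else 0) - (if τ m = b then 1 else 0) := by
    intro m
    have hA : τ m = a → s m = 1 ∧ s (τ m) = -1 := by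
      intro h
      have e1 := ha m
      have e2 := ha (τ (τ m))
      rw [← h] at e1 e2
      constructor
      · refine (hs m).elim (·.1) fun h => ?_
        have := h.2
        rw [cross_sub_left] at this
        linarith
      · refine (hs (τ m)).elim (fun h => ?_) (·.1)
        have := h.2
        rw [cross_sub_left] at this
        linarith
    have hB : τ m = b → s m = -1 ∧ s (τ m) = 1 := by
      intro h
      have e1 := hb m
      have e2 := hb (τ (τ m))
      rw [← h] at e1 e2
      constructor
      · refine (hs m).elim (fun h => ?_) (·.1)
        have := h.2
        rw [cross_sub_left] at this
        linarith
      · refine (hs (τ m)).elim (·.1) fun h => ?_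
        have := h.2
        rw [cross_sub_left] at this
        linarith
    have hm := hmax m
    have hm' := hmin m
    have c1 : s m = 1 ∨ s m = -1 := (hs m).imp (·.1) (·.1)
    have c2 : s (τ m) = 1 ∨ s (τ m) = -1 := (hs (τ m)).imp (·.1) (·.1)
    have hne : (1 : ℝ) ≠ -1 := by norm_num
    rcases c1 with c1 | c1 <;> rcases c2 with c2 | c2
    · rw [if_neg fun h => hne ((hA h).2 ▸ c2.symm), if_neg fun h => hne (c1.symm.trans (hB h).1),
        c1, c2]
      simp
    · rw [if_pos (hm c1 c2), if_neg fun h => hne (c1.symm.trans (hB h).1), c1, c2]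
      norm_num
    · rw [if_pos (hm' c1 c2), if_neg fun h => hne ((hA h).1.symm.trans c1), c1, c2]
      norm_num
    · rw [if_neg fun h => hne ((hA h).1.symm.trans c1), if_neg fun h => hne ((hB h).2.symm.trans c2),
        c1, c2]
      simp
  have hsum : ∑ i, (s i / 2 : ℂ) * (z (τ i) - z i) = z a - z b := by
    have e1 : ∑ i, (s (τ i) / 2 : ℂ) * z (τ i) = ∑ i, (s i / 2 : ℂ) * z i :=
      Equiv.sum_comp τ fun i => (s i / 2 : ℂ) * z i
    have e2 : ∑ i, (s i / 2 : ℂ) * (z (τ i) - z i)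
        = ∑ i, (s i / 2 - s (τ i) / 2 : ℂ) * z (τ i) := by
      simp only [mul_sub, sub_mul, Finset.sum_sub_distrib, e1]
    rw [e2]
    simp only [hd]
    rw [Equiv.sum_comp τ fun i => ((if i = a then 1 else 0) - (if i = b then 1 else 0) : ℂ) * z i]
    simp [sub_mul, Finset.sum_sub_distrib]
  rw [hsum]
  exact hdiam a b

lemma norm_exp_mul_I_sub_exp_mul_I (a b : ℝ) (h0 : a ≤ b) (h1 : b ≤ a + 2 * π) :
    ‖Complex.exp (a * Complex.I) - Complex.exp (b * Complex.I)‖ = 2 * sin ((b - a) / 2) := by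
  have h : Complex.exp (a * Complex.I) - Complex.exp (b * Complex.I)
      = -(Complex.exp (a * Complex.I) * (Complex.exp (Complex.I * (b - a : ℝ)) - 1)) := by
    rw [mul_sub, ← Complex.exp_add]
    push_cast
    ring_nf
  rw [h, norm_neg, norm_mul, Complex.norm_exp_ofReal_mul_I, one_mul,
    Complex.norm_exp_I_mul_ofReal_sub_one, Real.norm_of_nonneg]
  have := sin_nonneg_of_nonneg_of_le_pi (x := (b - a) / 2) (by linarith) (by linarith)
  linarith

/-- Jensen's inequality for the half-angle sines of a partition of a straight angle, with its
equality case. -/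
lemma sum_sin_half_le (n : ℕ) (hn : 0 < n) (d : ℕ → ℝ) (hd : ∀ k < n, 0 ≤ d k)
    (hsum : ∑ k ∈ Finset.range n, d k = π) :
    ∑ k ∈ Finset.range n, 2 * sin (d k / 2) ≤ 2 * n * sin (π / (2 * n)) ∧
    (∑ k ∈ Finset.range n, 2 * sin (d k / 2) = 2 * n * sin (π / (2 * n)) →
      ∀ k < n, d k = π / n) := by
  have hn' : (0 : ℝ) < n := by exact_mod_cast hn
  have hw : ∀ i ∈ Finset.range n, 0 < (1 / n : ℝ) := fun _ _ => by positivity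
  have hw1 : ∑ i ∈ Finset.range n, (1 / n : ℝ) = 1 := by
    simp [hn'.ne']
  have hmem : ∀ i ∈ Finset.range n, d i / 2 ∈ Set.Icc 0 π := by
    intro i hi
    have h0 := hd i (Finset.mem_range.1 hi)
    have h1 : d i ≤ π := hsum ▸ Finset.single_le_sum
      (fun j hj => hd j (Finset.mem_range.1 hj)) hi
    constructor <;> linarith
  have havg : ∑ i ∈ Finset.range n, (1 / n : ℝ) • (d i / 2) = π / (2 * n) := by
    rw [← Finset.smul_sum, ← Finset.sum_div, hsum, smul_eq_mul]
    field_simp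
  have hval : ∑ i ∈ Finset.range n, (1 / n : ℝ) • sin (d i / 2)
      = (∑ k ∈ Finset.range n, 2 * sin (d k / 2)) / (2 * n) := by
    rw [← Finset.smul_sum, ← Finset.mul_sum, smul_eq_mul]
    field_simp
  have hle := strictConcaveOn_sin_Icc.concaveOn.le_map_sum (fun i hi => (hw i hi).le) hw1 hmem
  have heq := strictConcaveOn_sin_Icc.map_sum_eq_iff hw hw1 hmem
  rw [havg, hval] at hle heq
  refine ⟨?_, fun h k hk => ?_⟩
  · rw [div_le_iff₀ (by positivity)] at hle
    linarith
  · have := heq.1 (by rw [h]; field_simp) k (Finset.mem_range.2 hk)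
    field_simp at this ⊢
    linarith

/-- Half-turn symmetric polygonal lines in the unit disc whose edges have increasing directions:
if the length is at least that of half a regular inscribed `2n`-gon, then the line is one. -/
lemma exists_eq_mul_pow_of_le_sum (n : ℕ) (hn : 0 < n) (T r : ℕ → ℝ) (f v : ℕ → ℂ)
    (hf : ∀ k < n, f k = r k * Complex.exp (T k * Complex.I))
    (hv : ∀ k < n, v (k + 1) = v k + f k) (hvn : v n = -v 0)
    (hT : ∀ k < n, T k ≤ T (k + 1)) (hTn : T n = T 0 + π)
    (hnorm : ∀ k < n, T k < T (k + 1) → ‖v (k + 1)‖ ≤ 1)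
    (hle : 2 * n * sin (π / (2 * n)) ≤ ∑ k ∈ Finset.range n, r k) :
    ∃ C : ℂ, C ≠ 0 ∧ ∀ k < n, f k = C * Complex.exp (π / n * Complex.I) ^ k := by
  have hn' : (0 : ℝ) < n := by exact_mod_cast hn
  have hn1 : (1 : ℝ) ≤ n := by exact_mod_cast hn
  set u : ℕ → ℂ := fun k => Complex.exp (T k * Complex.I) with hu
  have hu1 : ∀ k, ‖u k‖ = 1 := fun k => Complex.norm_exp_ofReal_mul_I _
  have hun : u n = -u 0 := by
    simp only [hu, hTn]
    push_cast
    rw [add_mul, Complex.exp_add, Complex.exp_pi_mul_I]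
    ring
  have hdsum : ∑ k ∈ Finset.range n, (T (k + 1) - T k) = π := by
    rw [Finset.sum_range_sub, hTn]; ring
  have hd : ∀ k < n, 0 ≤ T (k + 1) - T k := fun k hk => sub_nonneg.2 (hT k hk)
  have hdle : ∀ k < n, T (k + 1) - T k ≤ π := fun k hk => hdsum ▸
    Finset.single_le_sum (f := fun k => T (k + 1) - T k)
      (fun j hj => hd j (Finset.mem_range.1 hj)) (Finset.mem_range.2 hk)
  have hdnorm : ∀ k < n, ‖u k - u (k + 1)‖ = 2 * sin ((T (k + 1) - T k) / 2) := fun k hk =>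
    norm_exp_mul_I_sub_exp_mul_I _ _ (hT k hk) (by linarith [hdle k hk, pi_pos])
  obtain ⟨hJ, hJeq⟩ := sum_sin_half_le n hn _ hd hdsum
  have hr : ∀ k < n, r k = inner ℝ (v (k + 1)) (u k - u (k + 1))
      + (inner ℝ (v (k + 1)) (u (k + 1)) - inner ℝ (v k) (u k)) := by
    intro k hk
    have h : (inner ℝ (f k) (u k) : ℝ) = r k := by
      rw [hf k hk, ← Complex.real_smul, real_inner_smul_left]
      change r k * inner ℝ (u k) (u k) = r k
      rw [real_inner_self_eq_norm_sq, hu1]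
      ring
    rw [← h, hv k hk, inner_sub_right, inner_add_left, inner_add_left]
    ring
  have hrsum : ∑ k ∈ Finset.range n, r k
      = ∑ k ∈ Finset.range n, (inner ℝ (v (k + 1)) (u k - u (k + 1)) : ℝ) := by
    rw [Finset.sum_congr rfl fun k hk => hr k (Finset.mem_range.1 hk), Finset.sum_add_distrib,
      Finset.sum_range_sub fun k => (inner ℝ (v k) (u k) : ℝ), hvn, hun, inner_neg_neg]
    ring
  have hterm : ∀ k ∈ Finset.range n, (inner ℝ (v (k + 1)) (u k - u (k + 1)) : ℝ)
      ≤ 2 * sin ((T (k + 1) - T k) / 2) := by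
    intro k hk
    rw [Finset.mem_range] at hk
    rcases (hT k hk).lt_or_eq with h | h
    · rw [← hdnorm k hk]
      refine (real_inner_le_norm _ _).trans ?_
      exact mul_le_of_le_one_left (norm_nonneg _) (hnorm k hk h)
    · have : u k = u (k + 1) := by simp only [hu, h]
      rw [this, h]
      simp
  have hsums := Finset.sum_le_sum hterm
  have heq1 := (Finset.sum_eq_sum_iff_of_le hterm).1 (by linarith)
  have hdel := hJeq (by linarith)
  set ω : ℂ := Complex.exp (π / n * Complex.I) with hω
  have hω0 : ω ≠ 0 := Complex.exp_ne_zero _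
  have hus : ∀ k < n, u (k + 1) = u k * ω := by
    intro k hk
    have : T (k + 1) = T k + π / n := by linarith [hdel k hk]
    simp only [hu, hω, this, ← Complex.exp_add]
    push_cast
    ring_nf
  have hup : ∀ k ≤ n, u k = u 0 * ω ^ k := by
    intro k
    induction k with
    | zero => simp
    | succ k ih =>
      intro hk
      rw [hus k hk, ih (by omega)]
      ring
  have hωn : ω ^ n = -1 := by
    have h := hup n le_rfl
    rw [hun] at h
    have h0 : u 0 ≠ 0 := Complex.exp_ne_zero _
    apply mul_left_cancel₀ h0
    rw [← h]
    ring
  set D : ℝ := 2 * sin (π / (2 * n)) with hD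
  have hDpos : 0 < D := by
    have : 0 < sin (π / (2 * n)) := by
      refine sin_pos_of_pos_of_lt_pi (by positivity) ?_
      rw [div_lt_iff₀ (by positivity)]
      nlinarith [pi_pos]
    positivity
  have hDk : ∀ k < n, 2 * sin ((T (k + 1) - T k) / 2) = D := by
    intro k hk
    rw [hdel k hk, hD, div_div, mul_comm (n : ℝ)]
  have hvk : ∀ k < n, (D : ℂ) * v (k + 1) = u 0 * ω ^ k * (1 - ω) := by
    intro k hk
    have hlt : T k < T (k + 1) := by
      have : 0 < π / n := by positivity
      linarith [hdel k hk]
    have h1 := hnorm k hk hlt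
    have h2 := heq1 k (Finset.mem_range.2 hk)
    have h3 := hdnorm k hk
    rw [hDk k hk] at h2 h3
    have h4 := real_inner_le_norm (v (k + 1)) (u k - u (k + 1))
    rw [h2, h3] at h4
    have h5 : ‖v (k + 1)‖ = 1 := le_antisymm h1 (by nlinarith)
    have h6 := (inner_eq_norm_mul_iff_real (x := v (k + 1)) (y := u k - u (k + 1))).1
      (by rw [h2, h3, h5, one_mul])
    rw [h3, h5, one_smul, Complex.real_smul, hus k hk, hup k hk.le] at h6
    rw [h6]
    ring
  have hvk' : ∀ k < n, (D : ℂ) * ω * v k = u 0 * ω ^ k * (1 - ω) := by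
    intro k hk
    cases k with
    | zero =>
      obtain ⟨m, rfl⟩ : ∃ m, n = m + 1 := ⟨n - 1, by omega⟩
      have h := hvk m (by omega)
      rw [hvn] at h
      rw [pow_succ] at hωn
      linear_combination (-ω) * h - u 0 * (1 - ω) * hωn
    | succ k =>
      linear_combination ω * hvk k (by omega)
  have hω1 : 1 - ω ≠ 0 := by
    intro h
    have := hus 0 hn
    rw [← sub_eq_zero.1 h, mul_one] at this
    have h0 := hdnorm 0 hn
    rw [this, sub_self, norm_zero, hDk 0 hn] at h0
    exact hDpos.ne h0
  have hDC : (D : ℂ) ≠ 0 := by exact_mod_cast hDpos.ne'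
  have hu0 : u 0 ≠ 0 := Complex.exp_ne_zero _
  refine ⟨-(u 0 * (1 - ω) ^ 2) / (D * ω), ?_, fun k hk => ?_⟩
  · exact div_ne_zero (neg_ne_zero.2 (mul_ne_zero hu0 (pow_ne_zero 2 hω1))) (mul_ne_zero hDC hω0)
  · have h : (D : ℂ) * ω * f k = -(u 0 * (1 - ω) ^ 2) * ω ^ k := by
      linear_combination ω * hvk k hk - hvk' k hk - D * ω * hv k hk
    field_simp
    linear_combination h

/-- For `n` a power of two, the first `n` powers of a primitive `2n`-th root of unity are linearly
independent over `ℚ`. -/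
lemma sum_mul_exp_pow_ne_zero (n : ℕ) (hpow : ∃ k : ℕ, n = 2 ^ k) (ε : ℕ → ℚ) (h0 : ε 0 ≠ 0) :
    ∑ k ∈ Finset.range n, (ε k : ℂ) * Complex.exp (π / n * Complex.I) ^ k ≠ 0 := by
  obtain ⟨m, rfl⟩ := hpow
  set n := 2 ^ m with hn
  have hnpos : 0 < n := by positivity
  have hprim := Complex.isPrimitiveRoot_exp (2 * n) (by omega)
  have hexp : Complex.exp (2 * π * Complex.I / (2 * n : ℕ)) = Complex.exp (π / n * Complex.I) := by
    congr 1
    have : (n : ℂ) ≠ 0 := by exact_mod_cast hnpos.ne'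
    push_cast
    field_simp
  rw [hexp] at hprim
  intro hsum
  set q : Polynomial ℚ := ∑ k ∈ Finset.range n, Polynomial.C (ε k) * Polynomial.X ^ k with hq
  have hq0 : q ≠ 0 := by
    intro h
    have : q.coeff 0 = ε 0 := by
      rw [hq, Polynomial.finsetSum_coeff]
      simp [Polynomial.coeff_X_pow, hnpos.ne']
    rw [h] at this
    exact h0 (by simpa using this.symm)
  have hev : Polynomial.aeval (Complex.exp (π / n * Complex.I)) q = 0 := by
    rw [hq, map_sum, ← hsum]
    simp
  have hdeg := minpoly.degree_le_of_ne_zero ℚ _ hq0 hev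
  rw [← Polynomial.cyclotomic_eq_minpoly_rat hprim (by omega), Polynomial.degree_cyclotomic,
    hn, ← pow_succ', Nat.totient_prime_pow_succ Nat.prime_two, ← hn] at hdeg
  have hlt : q.degree < n := by
    rw [hq, Finset.sum_range]
    exact Polynomial.degree_sum_fin_lt fun i : Fin n => ε i
  simp only [Nat.add_one_sub_one, mul_one] at hdeg
  exact absurd hlt (not_lt.2 hdeg)

/-- Every complex number is a signed multiple of a unit vector in the closed-open upper half
plane. -/
lemma exists_sign_mul_norm_mul_exp (x : ℂ) : ∃ (ε : ℚ) (θ : ℝ), (ε = 1 ∨ ε = -1) ∧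
    0 ≤ θ ∧ θ < π ∧ x = ε * (‖x‖ * Complex.exp (θ * Complex.I)) := by
  have h := Complex.norm_mul_exp_arg_mul_I x
  obtain ⟨h1, h2⟩ := Complex.arg_mem_Ioc x
  by_cases h0 : 0 ≤ x.arg
  · rcases h2.lt_or_eq with h2 | h2
    · exact ⟨1, x.arg, .inl rfl, h0, h2, by rw [h]; simp⟩
    · refine ⟨-1, 0, .inr rfl, le_rfl, pi_pos, ?_⟩
      rw [h2, Complex.exp_pi_mul_I] at h
      rw [← h]
      simp
  · refine ⟨-1, x.arg + π, .inr rfl, by linarith, by linarith, ?_⟩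
    push_cast
    rw [add_mul, Complex.exp_add, Complex.exp_pi_mul_I]
    linear_combination -h

lemma sum_range_succ_sub_half (f : ℕ → ℂ) (n k : ℕ) (hk : k < n) :
    ∑ j ∈ Finset.range n, (if j ≤ k then 1 else -1 : ℂ) / 2 * f j
      = ∑ j ∈ Finset.range (k + 1), f j - (∑ j ∈ Finset.range n, f j) / 2 := by
  have h : ∀ j, (if j ≤ k then 1 else -1 : ℂ) / 2 * f j = (if j ≤ k then f j else 0) - f j / 2 := by
    intro j
    split_ifs <;> ring
  have hfilter : (Finset.range n).filter (· ≤ k) = Finset.range (k + 1) := by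
    ext j
    simp only [Finset.mem_filter, Finset.mem_range]
    omega
  rw [Finset.sum_congr rfl fun j _ => h j, Finset.sum_sub_distrib, ← Finset.sum_filter, hfilter,
    Finset.sum_div]

/-- Reinhardt's strict inequality for the vertices of a convex polygon in the complex plane, with
cyclic successor `τ`. -/
lemma sum_norm_edges_lt (n : ℕ) (hn : 0 < n) (hpow : ∃ k : ℕ, n = 2 ^ k)
    (τ : Equiv.Perm (Fin n)) (h2 : ∀ i, τ (τ i) ≠ i) (z : Fin n → ℂ)
    (hconv : ∀ i j, j ≠ i → j ≠ τ i → 0 < cross (z (τ i) - z i) (z j - z i))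
    (hdiam : ∀ i j, ‖z i - z j‖ ≤ 1) :
    ∑ i, ‖z (τ i) - z i‖ < 2 * n * sin (π / (2 * n)) := by
  by_contra! hle
  have : Nonempty (Fin n) := ⟨⟨0, hn⟩⟩
  have h1 : ∀ i, τ i ≠ i := fun i hi => h2 i (by rw [hi, hi])
  have hr : ∀ i, 0 < ‖z (τ i) - z i‖ := by
    intro i
    rw [norm_pos_iff]
    intro h
    have := hconv i (τ (τ i)) (h2 i) (h1 _)
    rw [h] at this
    simp [cross] at this
  choose ε θ hε hθ0 hθπ hedge using fun i => exists_sign_mul_norm_mul_exp (z (τ i) - z i)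
  have hεε : ∀ i, (ε i : ℂ) * ε i = 1 := fun i => by rcases hε i with h | h <;> simp [h]
  set σ := Tuple.sort θ
  have hmono : Monotone (θ ∘ σ) := Tuple.monotone_sort θ
  set g : ℕ → Fin n := fun k => if h : k < n then σ ⟨k, h⟩ else σ ⟨0, hn⟩ with hg
  have hgk : ∀ k (h : k < n), g k = σ ⟨k, h⟩ := fun k h => by simp only [hg, dif_pos h]
  have hgσ : ∀ i : Fin n, g i = σ i := fun i => hgk i i.2
  set T : ℕ → ℝ := fun k => if k < n then θ (g k) else θ (g 0) + π with hTdef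
  have hTk : ∀ k < n, T k = θ (g k) := fun k h => by simp only [hTdef, if_pos h]
  have hTn : T n = T 0 + π := by simp only [hTdef, lt_irrefl, if_false, if_pos hn]
  have hTmono : ∀ a b, a ≤ b → b ≤ n → T a ≤ T b := by
    intro a b hab hb
    rcases hb.lt_or_eq with hb | rfl
    · rw [hTk a (hab.trans_lt hb), hTk b hb, hgk a (hab.trans_lt hb), hgk b hb]
      exact hmono (by simpa using hab)
    · rcases hab.lt_or_eq with hab | rfl
      · rw [hTn, hTk a hab, hTk 0 hn]
        linarith [hθ0 (g 0), hθπ (g a)]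
      · exact le_rfl
  set f : ℕ → ℂ := fun k => ‖z (τ (g k)) - z (g k)‖ * Complex.exp (θ (g k) * Complex.I) with hf
  have hedge' : ∀ k, z (τ (g k)) - z (g k) = ε (g k) * f k := fun k => hedge (g k)
  have hfε : ∀ k, f k = ε (g k) * (z (τ (g k)) - z (g k)) := by
    intro k
    rw [hedge', ← mul_assoc, hεε, one_mul]
  have hsumr : ∑ k ∈ Finset.range n, ‖z (τ (g k)) - z (g k)‖ = ∑ i, ‖z (τ i) - z i‖ := by
    rw [Finset.sum_range]
    simp only [hgσ]
    exact Equiv.sum_comp σ fun i => ‖z (τ i) - z i‖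
  set v : ℕ → ℂ := fun k => ∑ j ∈ Finset.range k, f j - (∑ j ∈ Finset.range n, f j) / 2 with hv
  have hnorm : ∀ k < n, T k < T (k + 1) → ‖v (k + 1)‖ ≤ 1 := by
    intro k hk hlt
    set φ : ℝ := (T k + T (k + 1)) / 2 with hφ
    have hTi : ∀ i, θ i = T (σ.symm i) := fun i => by
      rw [hTk _ (σ.symm i).2, hgσ, Equiv.apply_symm_apply]
    set s : Fin n → ℝ := fun i => (if (σ.symm i : ℕ) ≤ k then 1 else -1) * ε i with hs
    have hcross : ∀ i, cross (z (τ i) - z i) (Complex.exp (φ * Complex.I))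
        = ε i * (‖z (τ i) - z i‖ * sin (φ - θ i)) := by
      intro i
      have hre : (z (τ i) - z i).re = ε i * (‖z (τ i) - z i‖ * cos (θ i)) := by
        conv_lhs => rw [hedge i]
        rw [← Complex.ofReal_ratCast, Complex.re_ofReal_mul, Complex.re_ofReal_mul,
          Complex.exp_ofReal_mul_I_re]
      have him : (z (τ i) - z i).im = ε i * (‖z (τ i) - z i‖ * sin (θ i)) := by
        conv_lhs => rw [hedge i]
        rw [← Complex.ofReal_ratCast, Complex.im_ofReal_mul, Complex.im_ofReal_mul,
          Complex.exp_ofReal_mul_I_im]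
      rw [cross, hre, him, Complex.exp_ofReal_mul_I_re, Complex.exp_ofReal_mul_I_im, sin_sub]
      ring
    have hsin : ∀ i, if (σ.symm i : ℕ) ≤ k then 0 < ‖z (τ i) - z i‖ * sin (φ - θ i)
        else ‖z (τ i) - z i‖ * sin (φ - θ i) < 0 := by
      intro i
      have hi := (σ.symm i).2
      have e1 := hTmono 0 (σ.symm i) (by omega) hi.le
      have e2 := hTmono (σ.symm i) n hi.le le_rfl
      have e3 := hTmono (k + 1) n (by omega) le_rfl
      have e4 := hTmono 0 k (by omega) hk.le
      split_ifs with h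
      · have e5 := hTmono _ _ h hk.le
        refine mul_pos (hr i) (sin_pos_of_pos_of_lt_pi ?_ ?_) <;> rw [hTi, hφ] <;> linarith
      · have e5 := hTmono (k + 1) (σ.symm i) (by omega) hi.le
        refine mul_neg_of_pos_of_neg (hr i) (sin_neg_of_neg_of_neg_pi_lt ?_ ?_) <;>
          rw [hTi, hφ] <;> linarith
    have hsi : ∀ i, (s i = 1 ∧ 0 < cross (z (τ i) - z i) (Complex.exp (φ * Complex.I))) ∨
        (s i = -1 ∧ cross (z (τ i) - z i) (Complex.exp (φ * Complex.I)) < 0) := by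
      intro i
      have h := hsin i
      rw [hcross]
      simp only [hs]
      split_ifs at h ⊢ with hc <;> rcases hε i with h' | h' <;> rw [h'] <;> norm_num <;> linarith
    have hmain := norm_sum_sign_edges_le τ h2 z hconv hdiam _ s hsi
    rw [← Equiv.sum_comp σ] at hmain
    have hsum : ∑ i : Fin n, (s (σ i) / 2 : ℂ) * (z (τ (σ i)) - z (σ i)) = v (k + 1) := by
      simp only [hv]
      rw [← sum_range_succ_sub_half f n k hk, Finset.sum_range]
      refine Finset.sum_congr rfl fun i _ => ?_
      rw [hfε, hgσ]
      simp only [hs, Equiv.symm_apply_apply]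
      push_cast
      split_ifs <;> push_cast <;> ring
    rwa [hsum] at hmain
  obtain ⟨C, hC, hfC⟩ := exists_eq_mul_pow_of_le_sum n hn T (fun k => ‖z (τ (g k)) - z (g k)‖) f v
    (fun k hk => by rw [hTk k hk]) (fun k _ => by simp only [hv, Finset.sum_range_succ]; ring)
    (by simp only [hv, Finset.sum_range_zero]; ring)
    (fun k hk => hTmono k (k + 1) (by omega) hk) hTn hnorm (hsumr ▸ hle)
  refine sum_mul_exp_pow_ne_zero n hpow (fun k => ε (g k))
    (by rcases hε (g 0) with h | h <;> simp [h]) ?_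
  have hclosed : ∑ k ∈ Finset.range n, (z (τ (g k)) - z (g k)) = 0 := by
    rw [Finset.sum_range]
    simp only [hgσ]
    rw [Equiv.sum_comp σ fun i => z (τ i) - z i, Finset.sum_sub_distrib, Equiv.sum_comp τ z,
      sub_self]
  apply mul_left_cancel₀ hC
  rw [mul_zero, ← hclosed, Finset.mul_sum]
  refine Finset.sum_congr rfl fun k hk => ?_
  rw [hedge', hfC k (Finset.mem_range.1 hk)]
  ring

/-- The cyclic successor as a permutation. -/
noncomputable def vnextPerm (n : ℕ) : Equiv.Perm (Fin n) :=
  Equiv.ofBijective vnext <| Finite.injective_iff_bijective.1 fun i j h => by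
    have hi := i.2
    have hj := j.2
    have h' : (i.1 + 1) % n = (j.1 + 1) % n := congrArg Fin.val h
    have h'' : i.1 ≡ j.1 [MOD n] := Nat.ModEq.add_right_cancel' 1 h'
    exact Fin.ext (Nat.ModEq.eq_of_lt_of_lt h'' hi hj)

lemma vnext_vnext_ne {n : ℕ} (hn : 3 ≤ n) (i : Fin n) : vnext (vnext i) ≠ i := by
  intro h
  have h' : ((i.1 + 1) % n + 1) % n = i.1 := congrArg Fin.val h
  rw [Nat.mod_add_mod, add_assoc] at h'
  have hm : i.1 + 2 ≡ i.1 + 0 [MOD n] := h'.trans (Nat.mod_eq_of_lt i.2).symm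
  have h2 : 2 % n = 0 % n := Nat.ModEq.add_left_cancel' i.1 hm
  rw [Nat.mod_eq_of_lt (by omega), Nat.zero_mod] at h2
  omega

/-- Non-attainability in Reinhardt's theorem: if `n ≥ 4` is a power of `2`,
every convex `n`-gon of diameter at most `1` has perimeter strictly less than
`2 n sin (π / (2 n))`. -/
theorem perimeter_lt_of_small_convex_polygon_pow_two (n : ℕ) (hn : 4 ≤ n)
    (hpow : ∃ k : ℕ, n = 2 ^ k)
    (p : Fin n → EuclideanSpace ℝ (Fin 2)) (hconv : IsConvexPolygon p)
    (hdiam : ∀ i j : Fin n, dist (p i) (p j) ≤ 1) :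
    perimeter p < 2 * n * Real.sin (π / (2 * n)) := by
  set z : Fin n → ℂ := fun i => ⟨p i 0, p i 1⟩ with hz
  have hdist : ∀ i j, dist (p i) (p j) = ‖z i - z j‖ := by
    intro i j
    rw [EuclideanSpace.dist_eq, Fin.sum_univ_two, Complex.norm_eq_sqrt_sq_add_sq, Real.dist_eq,
      Real.dist_eq, sq_abs, sq_abs]
    simp only [hz, Complex.sub_re, Complex.sub_im]
  have hmain := sum_norm_edges_lt n (by omega) hpow (vnextPerm n)
    (fun i => vnext_vnext_ne (by omega) i) z
    (fun i j hij hij' => hconv i j hij hij') (fun i j => hdist i j ▸ hdiam i j)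
  refine lt_of_eq_of_lt (Finset.sum_congr rfl fun i _ => ?_) hmain
  rw [dist_comm, hdist]
  rfl
end

section
/- There exist 32 points in the Euclidean plane, in convex position, with all pairwise distances at most 1, such that the perimeter of the convex polygon they span is strictly greater than 3.1403311569546. -/
open Real

/-- Horizontal coordinates of the vertices, in units of `10 ^ (-17)`. -/
def xCoord : Fin 32 → ℤ :=
  ![-51418192492362500, -49033714251122817, -44837918868372495, -38247604725376991,
    -30976319463609202, -22559045451553507, -13687797599606799, -4168445565773700,
    5538787759030238, 15246041744260578, 24485869686388020, 32903190711880525,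
    38749115265517279, 43794289502852854, 46178799728005674, 47618753932980928,
    48100284479084887, 46660335047521914, 43354237417111665, 38309039863918177,
    32463080590903785, 24580716805619452, 15340773660156664, 5538993122603784,
    -4262789392739876, -13782285602899206, -22653665574863702, -30536007773605535,
    -37807391734525097, -44397789587829724, -48593625712680165, -51899715520915111]

/-- Vertical coordinates of the vertices, in units of `10 ^ (-17)`. -/
def yCoord : Fin 32 → ℤ :=
  ![-4907522878615166, -14426904046748242, -23298174824716448, -30569461428138018,
    -37159777051419129, -42204903576300407, -46400706836156584, -48785195508476544,
    -50225150559955739, -48785232445557841, -45479187390354710, -40434059793918320,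
    -32551759806226977, -24134414387527716, -14614949055539082, -4907599205638445,
    4894147452685298, 14601511838872374, 23841443011205136, 32258852215710684,
    40141209492889976, 45987175514382172, 49293295330211368, 49774849439833388,
    49293335588788996, 46908843710838251, 42713013032093109, 36867092173688883,
    30276713996856116, 23005347869645246, 14134020674903071, 4894147452685298]

/-- Lower bounds for the side lengths, in units of `10 ^ (-17)`. -/
def sideBound : Fin 32 → ℤ :=
  ![9813478196192832, 9813467486568727, 9813452469567708, 9813452469567708,
    9813450129597073, 9813450129597072, 9813452469567708, 9813452469567709,
    9813467486568726, 9813478196192831, 9813491005270358, 9813535906225239,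
    9813535906225239, 9813567609223050, 9813567609223051, 9813567609223051,
    9813581287770113, 9813593104019085, 9813602603878163, 9813602603878165,
    9813611851301398, 9813611851301397, 9813602603878164, 9813602603878164,
    9813593104019083, 9813581287770112, 9813567609223051, 9813567609223051,
    9813567609223051, 9813535906225239, 9813535906225239, 9813491005270358]

theorem xCoord_yCoord_cross_pos : ∀ i j : Fin 32, j ≠ i → j ≠ vnext i →
    0 < (xCoord (vnext i) - xCoord i) * (yCoord j - yCoord i) -
        (yCoord (vnext i) - yCoord i) * (xCoord j - xCoord i) := by
  decide +kernel

theorem xCoord_yCoord_sq_dist_le : ∀ i j : Fin 32,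
    (xCoord i - xCoord j) ^ 2 + (yCoord i - yCoord j) ^ 2 ≤ (10 ^ 17) ^ 2 := by
  decide +kernel

theorem sideBound_sq_le : ∀ i : Fin 32, sideBound i ^ 2 ≤
    (xCoord i - xCoord (vnext i)) ^ 2 + (yCoord i - yCoord (vnext i)) ^ 2 := by
  decide +kernel

theorem lt_sum_sideBound : 31403311569546 * 10 ^ 4 < ∑ i, sideBound i := by
  decide +kernel

/-- The point of the plane with coordinates `x` and `y` in units of `10 ^ (-17)`. -/
noncomputable def scaledPoint (x y : ℤ) : EuclideanSpace ℝ (Fin 2) :=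
  !₂[(x : ℝ) / 10 ^ 17, (y : ℝ) / 10 ^ 17]

theorem dist_scaledPoint (x y x' y' : ℤ) :
    dist (scaledPoint x y) (scaledPoint x' y') =
      √(((x - x') ^ 2 + (y - y') ^ 2 : ℤ) : ℝ) / 10 ^ 17 := by
  rw [EuclideanSpace.dist_eq, Fin.sum_univ_two, Real.dist_eq, Real.dist_eq, sq_abs, sq_abs,
    eq_div_iff (by positivity), ← Real.sqrt_sq (show (0 : ℝ) ≤ 10 ^ 17 by positivity),
    ← Real.sqrt_mul (by positivity)]
  congr 1
  simp only [scaledPoint, PiLp.toLp_apply, Matrix.cons_val_zero, Matrix.cons_val_one]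
  push_cast
  field_simp

/-- There is a convex `32`-gon of diameter at most `1` whose perimeter exceeds
`3.1403311569546`. -/
theorem exists_small_32gon_long_perimeter :
    ∃ p : Fin 32 → EuclideanSpace ℝ (Fin 2), IsConvexPolygon p ∧
      (∀ i j : Fin 32, dist (p i) (p j) ≤ 1) ∧
      3.1403311569546 < perimeter p := by
  refine ⟨fun i => scaledPoint (xCoord i) (yCoord i), fun i j hi hj => ?_, fun i j => ?_, ?_⟩
  · have h : (0 : ℝ) < ((xCoord (vnext i) - xCoord i) * (yCoord j - yCoord i) -
        (yCoord (vnext i) - yCoord i) * (xCoord j - xCoord i) : ℤ) :=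
      Int.cast_pos.2 (xCoord_yCoord_cross_pos i j hi hj)
    simp only [scaledPoint, PiLp.toLp_apply, Matrix.cons_val_zero, Matrix.cons_val_one]
    push_cast at h
    refine (div_pos h (show (0 : ℝ) < (10 ^ 17) ^ 2 by positivity)).trans_eq ?_
    ring
  · rw [dist_scaledPoint, div_le_one (by positivity), Real.sqrt_le_left (by positivity)]
    exact_mod_cast xCoord_yCoord_sq_dist_le i j
  · have h : ∀ i, (sideBound i : ℝ) / 10 ^ 17 ≤ dist (scaledPoint (xCoord i) (yCoord i))
        (scaledPoint (xCoord (vnext i)) (yCoord (vnext i))) := fun i => by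
      rw [dist_scaledPoint]
      gcongr
      exact Real.le_sqrt_of_sq_le (mod_cast sideBound_sq_le i)
    refine lt_of_lt_of_le ?_ (Finset.sum_le_sum fun i _ => h i)
    have hs : ((31403311569546 * 10 ^ 4 : ℤ) : ℝ) < (∑ i, sideBound i : ℤ) :=
      Int.cast_lt.2 lt_sum_sideBound
    rw [← Finset.sum_div, lt_div_iff₀ (by positivity), ← Int.cast_sum]
    refine lt_of_eq_of_lt ?_ hs
    norm_num
end

section
/- There exist 32 points in the Euclidean plane, in convex position, with all pairwise distances at most 1, such that the perimeter of the convex polygon they span exceeds 64·sin(π/64) − 2·10⁻¹³. -/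
open Real

/-- Integer vertices, in counterclockwise order, of a convex `32`-gon of diameter at most `10 ^ 20`.
Up to rounding, it is inscribed in a Reuleaux polygon and symmetric about the vertical axis. -/
def latticeVertex : Fin 32 → ℤ × ℤ :=
  ![(-49999999999999999950, -640117870858628783),
    (-49518472565086139750, -10441832940793957093),
    (-48078527633756053589, -20149152116421635673),
    (-43033378372168188394, -28566460156336869862),
    (-36443043784741944589, -35837762951085929536),
    (-28560788648379302706, -41683633123714319204),
    (-19320986369173672340, -44989673536905150836),
    (-9801629603394235622, -47374143318276646598),
    (0, -47855662335507090666),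
    (9801629603394235622, -47374143318276646598),
    (19320986369173672340, -44989673536905150836),
    (28560788648379302706, -41683633123714319204),
    (36443043784741944589, -35837762951085929536),
    (43033378372168188394, -28566460156336869862),
    (48078527633756053589, -20149152116421635673),
    (49518472565086139750, -10441832940793957093),
    (49999999999999999949, -640117870858628783),
    (47615495818038745063, 8879348974873916590),
    (44309399728644933514, 18119253620945043476),
    (40113551456926524625, 26990610140751329073),
    (34267601622290608536, 34872947879175889288),
    (26996203797899940900, 41463348723638811567),
    (18578792494289048119, 46508542774682622433),
    (9707394987899813383, 50704386235832615873),
    (0, 52144337664492909233),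
    (-9707394987899813383, 50704386235832615873),
    (-18578792494289048119, 46508542774682622433),
    (-26996203797899940900, 41463348723638811567),
    (-34267601622290608536, 34872947879175889288),
    (-40113551456926524625, 26990610140751329073),
    (-44309399728644933514, 18119253620945043476),
    (-47615495818038745063, 8879348974873916590)]

/-- The squared length of the side of the lattice polygon starting at vertex `i`. -/
def sideSq (i : Fin 32) : ℤ :=
  ((latticeVertex i).1 - (latticeVertex (vnext i)).1) ^ 2 +
    ((latticeVertex i).2 - (latticeVertex (vnext i)).2) ^ 2

theorem latticeVertex_convex : ∀ i j : Fin 32, j ≠ i → j ≠ vnext i →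
    0 < ((latticeVertex (vnext i)).1 - (latticeVertex i).1) *
          ((latticeVertex j).2 - (latticeVertex i).2) -
        ((latticeVertex (vnext i)).2 - (latticeVertex i).2) *
          ((latticeVertex j).1 - (latticeVertex i).1) := by
  decide +kernel

theorem latticeVertex_distSq_le : ∀ i j : Fin 32,
    ((latticeVertex i).1 - (latticeVertex j).1) ^ 2 +
      ((latticeVertex i).2 - (latticeVertex j).2) ^ 2 ≤ (10 ^ 20) ^ 2 := by
  decide +kernel

theorem le_sum_natSqrt_sideSq :
    314033115695461936200 ≤ ∑ i : Fin 32, Nat.sqrt (sideSq i).toNat := by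
  decide +kernel

/-- The polygon `latticeVertex` scaled by `10 ^ (-20)`. -/
noncomputable def scaledVertex (i : Fin 32) : EuclideanSpace ℝ (Fin 2) :=
  !₂[((latticeVertex i).1 : ℝ) / 10 ^ 20, ((latticeVertex i).2 : ℝ) / 10 ^ 20]

theorem dist_scaledVertex (i j : Fin 32) :
    dist (scaledVertex i) (scaledVertex j) =
      √((((latticeVertex i).1 - (latticeVertex j).1) ^ 2 +
        ((latticeVertex i).2 - (latticeVertex j).2) ^ 2 : ℤ) : ℝ) / 10 ^ 20 := by
  rw [EuclideanSpace.dist_eq, Fin.sum_univ_two, Real.dist_eq, Real.dist_eq, sq_abs, sq_abs,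
    eq_div_iff (by positivity), ← Real.sqrt_sq (by positivity : (0 : ℝ) ≤ 10 ^ 20),
    ← Real.sqrt_mul (by positivity)]
  congr 1
  simp only [scaledVertex, PiLp.toLp_apply, Matrix.cons_val_zero, Matrix.cons_val_one]
  push_cast
  ring

theorem isConvexPolygon_scaledVertex : IsConvexPolygon scaledVertex := by
  intro i j hi hj
  have h : (0 : ℝ) < (((latticeVertex (vnext i)).1 - (latticeVertex i).1) *
          ((latticeVertex j).2 - (latticeVertex i).2) -
        ((latticeVertex (vnext i)).2 - (latticeVertex i).2) *
          ((latticeVertex j).1 - (latticeVertex i).1) : ℤ) :=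
    Int.cast_pos.mpr (latticeVertex_convex i j hi hj)
  have h' := div_pos h (by positivity : (0 : ℝ) < (10 ^ 20) ^ 2)
  simp only [scaledVertex, PiLp.toLp_apply, Matrix.cons_val_zero, Matrix.cons_val_one]
  refine h'.trans_eq ?_
  push_cast
  ring

theorem dist_scaledVertex_le_one (i j : Fin 32) : dist (scaledVertex i) (scaledVertex j) ≤ 1 := by
  rw [dist_scaledVertex, div_le_one (by positivity)]
  exact Real.sqrt_le_iff.mpr ⟨by positivity, by exact_mod_cast latticeVertex_distSq_le i j⟩

theorem le_perimeter_scaledVertex : 3.140331156954619362 ≤ perimeter scaledVertex := by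
  have hside (i : Fin 32) : (Nat.sqrt (sideSq i).toNat : ℝ) / 10 ^ 20 ≤
      dist (scaledVertex i) (scaledVertex (vnext i)) := by
    rw [dist_scaledVertex]
    have hnn : (0 : ℤ) ≤ sideSq i := by unfold sideSq; positivity
    have hcast : (((sideSq i).toNat : ℕ) : ℝ) = ((sideSq i : ℤ) : ℝ) := by
      exact_mod_cast congrArg (Int.cast (R := ℝ)) (Int.toNat_of_nonneg hnn)
    refine div_le_div_of_nonneg_right ?_ (by positivity)
    exact (Real.nat_sqrt_le_real_sqrt (a := (sideSq i).toNat)).trans_eq (congrArg _ hcast)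
  have hsum : (314033115695461936200 : ℝ) ≤ ∑ i : Fin 32, (Nat.sqrt (sideSq i).toNat : ℝ) := by
    exact_mod_cast le_sum_natSqrt_sideSq
  calc (3.140331156954619362 : ℝ) = 314033115695461936200 / 10 ^ 20 := by norm_num
    _ ≤ (∑ i : Fin 32, (Nat.sqrt (sideSq i).toNat : ℝ)) / 10 ^ 20 := by gcongr
    _ = ∑ i : Fin 32, (Nat.sqrt (sideSq i).toNat : ℝ) / 10 ^ 20 := Finset.sum_div ..
    _ ≤ perimeter scaledVertex := Finset.sum_le_sum fun i _ => hside i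

theorem sin_pi_div_sixty_four_lt : 64 * Real.sin (π / 64) < 3.14033115695480 := by
  have hsin : Real.sin (π / 64) = √(2 - √(2 + √(2 + √(2 + √2)))) / 2 := by
    have h := Real.sin_pi_over_two_pow_succ 4
    norm_num [Real.sqrtTwoAddSeries] at h
    exact h
  have h₁ : 1.4142135623730950488016887 ≤ √2 := Real.le_sqrt_of_sq_le (by norm_num)
  have h₂ : 1.847759065022573512256366 ≤ √(2 + √2) := Real.le_sqrt_of_sq_le (by linarith)
  have h₃ : 1.96157056080646089825236 ≤ √(2 + √(2 + √2)) := Real.le_sqrt_of_sq_le (by linarith)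
  have h₄ : 1.9903694533443937724896 ≤ √(2 + √(2 + √(2 + √2))) :=
    Real.le_sqrt_of_sq_le (by linarith)
  have h₅ : √(2 - √(2 + √(2 + √(2 + √2)))) < 2 * 3.14033115695480 / 64 :=
    (Real.sqrt_lt' (by norm_num)).mpr (by linarith)
  rw [hsin]
  linarith

/-- There is a convex `32`-gon of diameter at most `1` whose perimeter exceeds
`64 sin (π / 64) - 2 * 10 ^ (-13)`. -/
theorem exists_small_32gon_perimeter_near_bound :
    ∃ p : Fin 32 → EuclideanSpace ℝ (Fin 2), IsConvexPolygon p ∧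
      (∀ i j : Fin 32, dist (p i) (p j) ≤ 1) ∧
      64 * Real.sin (π / 64) - 2 / 10 ^ 13 < perimeter p :=
  ⟨scaledVertex, isConvexPolygon_scaledVertex, dist_scaledVertex_le_one, by
    linarith [le_perimeter_scaledVertex, sin_pi_div_sixty_four_lt]⟩
end
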